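/- arXiv:2104.00289 — 4 statements merged into one kernel-verified Lean document; each statement's English description precedes it below -/
import Mathlib

section
/- Let m > 1. There exist real numbers L > 1 and U ≥ L, depending only on m, such that for all real numbers a, b, c with 1/m < a < m, 1/m < b < m and 1/m < c < m, the quantity E = (cosh a + cosh b · cosh c)/(sinh b · sinh c) satisfies L ≤ E ≤ U. (Consequently, in a right-angled hyperbolic hexagon whose three pairwise non-adjacent sides all have length in (1/m, m), every side has length bounded below and above by positive constants depending only on m.) -/
/-- Lemma 1.3 (bound for the sides of a right-angled hexagon): for `m > 1` there
are constants `L > 1` and `U ≥ L`, depending only on `m`, bounding the hexagon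
quantity `(cosh a + cosh b * cosh c) / (sinh b * sinh c)` from below and above
whenever `a, b, c ∈ (1/m, m)`. -/
theorem hexagon_side_bounds (m : ℝ) (hm : 1 < m) :
    ∃ L U : ℝ, 1 < L ∧ L ≤ U ∧
      ∀ a b c : ℝ,
        1 / m < a → a < m → 1 / m < b → b < m → 1 / m < c → c < m →
        L ≤ (Real.cosh a + Real.cosh b * Real.cosh c) / (Real.sinh b * Real.sinh c) ∧
        (Real.cosh a + Real.cosh b * Real.cosh c) / (Real.sinh b * Real.sinh c) ≤ U := by
  have hm0 : 0 < m := by linarith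
  have hi : 0 < 1 / m := by positivity
  have hi1 : 1 / m < 1 := by rw [div_lt_one hm0]; exact hm
  have hs : 0 < Real.sinh (1 / m) := Real.sinh_pos_iff.2 hi
  have hS : 0 < Real.sinh m := Real.sinh_pos_iff.2 hm0
  have key : ∀ a b c : ℝ,
        1 / m < a → a < m → 1 / m < b → b < m → 1 / m < c → c < m →
        1 + 1 / (Real.sinh m * Real.sinh m) ≤
          (Real.cosh a + Real.cosh b * Real.cosh c) / (Real.sinh b * Real.sinh c) ∧
        (Real.cosh a + Real.cosh b * Real.cosh c) / (Real.sinh b * Real.sinh c) ≤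
          (Real.cosh m + Real.cosh m * Real.cosh m) /
            (Real.sinh (1 / m) * Real.sinh (1 / m)) := by
    have hc : ∀ x : ℝ, 1 / m < x → x < m → Real.cosh x ≤ Real.cosh m := by
      intro x h1 h2
      rw [Real.cosh_le_cosh, abs_of_pos (by linarith), abs_of_pos hm0]
      exact h2.le
    intro a b c ha ha' hb hb' hc1 hc'
    have b1 := Real.sinh_le_sinh.2 hb.le
    have b2 := Real.sinh_le_sinh.2 hb'.le
    have c1 := Real.sinh_le_sinh.2 hc1.le
    have c2 := Real.sinh_le_sinh.2 hc'.le
    have b0 : 0 < Real.sinh b := by linarith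
    have c0 : 0 < Real.sinh c := by linarith
    have a3 := hc a ha ha'
    have b3 := hc b hb hb'
    have c3 := hc c hc1 hc'
    have bp := Real.cosh_pos b
    have cp := Real.cosh_pos c
    have mp := Real.cosh_pos m
    constructor
    · have h1 : 1 / (Real.sinh m * Real.sinh m) ≤ 1 / (Real.sinh b * Real.sinh c) := by
        gcongr
      have h2 : 1 + 1 / (Real.sinh b * Real.sinh c) =
          (1 + Real.sinh b * Real.sinh c) / (Real.sinh b * Real.sinh c) := by
        field_simp
        ring
      have h3 : (1 + Real.sinh b * Real.sinh c) / (Real.sinh b * Real.sinh c) ≤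
          (Real.cosh a + Real.cosh b * Real.cosh c) / (Real.sinh b * Real.sinh c) := by
        have := Real.one_le_cosh a
        have := (Real.sinh_lt_cosh b).le
        have := (Real.sinh_lt_cosh c).le
        gcongr
      linarith
    · gcongr
  have h1 := key 1 1 1 hi1 hm hi1 hm hi1 hm
  refine ⟨_, _, ?_, h1.1.trans h1.2, key⟩
  have : 0 < 1 / (Real.sinh m * Real.sinh m) := by positivity
  linarith
end

section
/- Let m > 1 and let a, b, c be real numbers with 1/m < a < m, 1/m < b < m and 1/m < c < m. Then (cosh a + cosh b · cosh c)/(sinh b · sinh c) ≥ 1 + e^{-2m}. -/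
/-- Lower bound from the proof of Lemma 1.3: for `m > 1` and
`a, b, c ∈ (1/m, m)`, the hexagon quantity is at least `1 + e^{-2m}`. -/
theorem hexagon_quantity_lower_bound (m a b c : ℝ) (hm : 1 < m)
    (ha1 : 1 / m < a) (ha2 : a < m)
    (hb1 : 1 / m < b) (hb2 : b < m)
    (hc1 : 1 / m < c) (hc2 : c < m) :
    1 + Real.exp (-2 * m) ≤
      (Real.cosh a + Real.cosh b * Real.cosh c) / (Real.sinh b * Real.sinh c) := by
  have hm0 : 0 < 1 / m := by positivity
  have hb : 0 < Real.sinh b := Real.sinh_pos_iff.mpr (hm0.trans hb1)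
  have hc : 0 < Real.sinh c := Real.sinh_pos_iff.mpr (hm0.trans hc1)
  have hcc : Real.sinh c < Real.cosh c := Real.sinh_lt_cosh c
  have ha : 0 < Real.cosh a := Real.cosh_pos a
  have h1 : Real.cosh b - Real.sinh b = Real.exp (-b) := Real.cosh_sub_sinh b
  have h2 : Real.sinh b ≤ Real.exp b := by
    have := Real.cosh_add_sinh b
    have := Real.cosh_pos b
    linarith
  have h3 : Real.exp (-2 * m) * Real.sinh b ≤ Real.exp (-b) := by
    calc Real.exp (-2 * m) * Real.sinh b ≤ Real.exp (-2 * b) * Real.exp b := by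
          apply mul_le_mul _ h2 hb.le (Real.exp_pos _).le
          exact Real.exp_le_exp.mpr (by linarith)
      _ = Real.exp (-b) := by rw [← Real.exp_add]; congr 1; ring
  have h4 : (1 + Real.exp (-2 * m)) * Real.sinh b ≤ Real.cosh b := by linarith
  have h5 := mul_le_mul h4 hcc.le hc.le (Real.cosh_pos b).le
  rw [le_div_iff₀ (mul_pos hb hc), ← mul_assoc]
  linarith
end

section
/- Let m ≥ 1 and let a, b be real numbers with 1/m ≤ a ≤ m and 1/m ≤ b ≤ m. Then (cosh(a/2) + cosh(a/2) · cosh b)/(sinh(a/2) · sinh b) ≥ 1 + e^{-2m}. -/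
/-- Lower bound (Case 2 of the proof of Lemma 1.5): for `m ≥ 1` and
`a, b ∈ [1/m, m]`,
`(cosh(a/2) + cosh(a/2) cosh b) / (sinh(a/2) sinh b) ≥ 1 + e^{-2m}`. -/
theorem delta_aa_lower_bound (m a b : ℝ) (hm : 1 ≤ m)
    (ha1 : 1 / m ≤ a) (ha2 : a ≤ m)
    (hb1 : 1 / m ≤ b) (hb2 : b ≤ m) :
    1 + Real.exp (-2 * m) ≤
      (Real.cosh (a / 2) + Real.cosh (a / 2) * Real.cosh b) /
        (Real.sinh (a / 2) * Real.sinh b) := by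
  have hm0 : 0 < 1 / m := by positivity
  have hs : 0 < Real.sinh (a / 2) := Real.sinh_pos_iff.mpr (by linarith)
  have hb : 0 < Real.sinh b := Real.sinh_pos_iff.mpr (by linarith)
  have h1 : Real.sinh (a / 2) ≤ Real.cosh (a / 2) := (Real.sinh_lt_cosh _).le
  have h2 : Real.sinh b ≤ Real.cosh b := (Real.sinh_lt_cosh _).le
  have h3 : Real.sinh b ≤ Real.exp (2 * m) := by
    have e1 := Real.cosh_add_sinh b
    have e2 := Real.cosh_pos b
    have e3 : Real.exp b ≤ Real.exp (2 * m) := Real.exp_le_exp.mpr (by linarith)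
    linarith
  have h4 : Real.exp (-2 * m) * Real.sinh b ≤ 1 := by
    calc Real.exp (-2 * m) * Real.sinh b ≤ Real.exp (-2 * m) * Real.exp (2 * m) :=
          mul_le_mul_of_nonneg_left h3 (Real.exp_pos _).le
      _ = 1 := by rw [← Real.exp_add]; simp
  have h5 : (1 + Real.exp (-2 * m)) * Real.sinh b ≤ 1 + Real.cosh b := by linarith
  rw [le_div_iff₀ (mul_pos hs hb)]
  calc (1 + Real.exp (-2 * m)) * (Real.sinh (a / 2) * Real.sinh b)
      = Real.sinh (a / 2) * ((1 + Real.exp (-2 * m)) * Real.sinh b) := by ring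
    _ ≤ Real.sinh (a / 2) * (1 + Real.cosh b) := mul_le_mul_of_nonneg_left h5 hs.le
    _ ≤ Real.cosh (a / 2) * (1 + Real.cosh b) :=
        mul_le_mul_of_nonneg_right h1 (by linarith)
    _ = Real.cosh (a / 2) + Real.cosh (a / 2) * Real.cosh b := by ring
end

section
/- Let c, d be real numbers and define f : ℂ → ℂ by f(z) = z · exp(c · arg z + d), where arg is the principal argument (Complex.arg) and exp is the real exponential (coerced to ℂ). Then for every z ∈ ℂ with Im z > 0, f is real-differentiable at z (differentiable over ℝ), and, writing D = fderiv ℝ f z, f_z = (1/2)·(D 1 − i·(D i)) and f_{z̄} = (1/2)·(D 1 + i·(D i)), one has f_z ≠ 0 and f_{z̄}/f_z = (c·i/(2 − c·i)) · (z / conj z). -/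
open Complex

/-- Beltrami coefficient of the Fenchel–Nielsen twist map `z ↦ z exp(c arg z + d)`
on the upper half-plane (Step 1 of the proof of Theorem 2.12): the map is
real-differentiable at every point of the upper half-plane, its Wirtinger
derivative `f_z` is nonzero, and `f_z̄ / f_z = (c i / (2 − c i)) · (z / z̄)`. -/
theorem beltrami_coefficient_of_twist_map (c d : ℝ) (f : ℂ → ℂ)
    (hf : ∀ z : ℂ, f z = z * ((Real.exp (c * Complex.arg z + d) : ℝ) : ℂ)) :
    ∀ z : ℂ, 0 < z.im →
      DifferentiableAt ℝ f z ∧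
      ∀ D : ℂ →L[ℝ] ℂ, D = fderiv ℝ f z →
        ∀ fz fzbar : ℂ,
          fz = (1 / 2 : ℂ) * (D 1 - Complex.I * D Complex.I) →
          fzbar = (1 / 2 : ℂ) * (D 1 + Complex.I * D Complex.I) →
          fz ≠ 0 ∧
            fzbar / fz =
              ((c : ℂ) * Complex.I / (2 - (c : ℂ) * Complex.I)) *
                (z / (starRingEnd ℂ) z) := by
  intro z hz
  have hz0 : z ≠ 0 := by
    rintro rfl
    simp at hz
  have hs : z ∈ slitPlane := Or.inr hz.ne'
  have h1 : HasFDerivAt Complex.arg (imCLM.comp (z⁻¹ • (1 : ℂ →L[ℝ] ℂ))) z := by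
    have h := imCLM.hasFDerivAt.comp z (hasStrictFDerivAt_log_real hs).hasFDerivAt
    refine h.congr_of_eventuallyEq (Filter.Eventually.of_forall fun w => ?_)
    simp [Complex.log_im]
  have h2 := ((h1.const_mul c).add_const d).exp
  have h3 := ofRealCLM.hasFDerivAt.comp z h2
  have h4 := (hasFDerivAt_id (𝕜 := ℝ) z).mul h3
  have hfe : f = fun y => id y * (ofRealCLM ∘ fun x => Real.exp (c * Complex.arg x + d)) y := by
    funext w
    simp [hf]
  have h5 := h4
  change HasFDerivAt (fun y => id y * (ofRealCLM ∘ fun x => Real.exp (c * Complex.arg x + d)) y) _ z at h5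
  rw [← hfe] at h5
  refine ⟨h5.differentiableAt, ?_⟩
  intro D hD fz fzbar hfz hfzbar
  rw [h5.fderiv] at hD
  set E : ℝ := Real.exp (c * Complex.arg z + d) with hE
  have hE0 : (E : ℂ) ≠ 0 := by
    exact_mod_cast (Real.exp_pos _).ne'
  have hDv : ∀ v, D v = v * E + z * (E * (c * ((z⁻¹ * v).im : ℝ))) := by
    intro v
    rw [hD]
    simp [← hE, -mul_im]
    ring
  have ha : (((z⁻¹).im : ℝ) : ℂ) - I * ((z⁻¹).re : ℝ) = - I * z⁻¹ := by
    apply Complex.ext <;> simp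
  have hb : (((z⁻¹).im : ℝ) : ℂ) + I * ((z⁻¹).re : ℝ) = I * ((starRingEnd ℂ) z)⁻¹ := by
    rw [← map_inv₀]
    apply Complex.ext <;> simp [neg_div]
  have hI : (z⁻¹ * I).im = (z⁻¹).re := by simp
  have hc0 : (starRingEnd ℂ) z ≠ 0 := by simpa using hz0
  have e1 : fz = E * (2 - c * I) / 2 := by
    rw [hfz, hDv, hDv, hI, mul_one]
    have : z * z⁻¹ = 1 := mul_inv_cancel₀ hz0
    linear_combination (z * E * c / 2) * ha - (E * c * I / 2) * this - (E / 2 : ℂ) * I_sq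
  have e2 : fzbar = E * (c * I) / 2 * (z / (starRingEnd ℂ) z) := by
    rw [hfzbar, hDv, hDv, hI, mul_one]
    linear_combination (z * E * c / 2) * hb + (E / 2 : ℂ) * I_sq
  have hc : (2 - (c : ℂ) * I) ≠ 0 := by
    intro h
    have := congrArg Complex.re h
    simp at this
  have hne : fz ≠ 0 := by
    rw [e1]
    exact div_ne_zero (mul_ne_zero hE0 hc) two_ne_zero
  refine ⟨hne, ?_⟩
  rw [e1, e2]
  field_simp
end
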